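/- arXiv:2402.11076 — 8 statements merged into one kernel-verified Lean document; each statement's English description precedes it below -/
import Mathlib

section
/- There exists a continuous map g : Δ → 𝓑 with g(λ₀) = x₀ such that for every λ ∈ Δ one has ‖g(λ) − x₀‖ ≤ δ and F(g(λ), λ) = 0, and moreover every solution of F(x, λ) = 0 with λ ∈ Δ and ‖x − x₀‖ ≤ δ satisfies x = g(λ). (Quantitative implicit function theorem, existence and uniqueness part, Theorem A.1.) -/
open Metric

/-- **Quantitative implicit function theorem (existence and uniqueness part).**
There exists a continuous map `g : Δ → 𝓑` with `g λ₀ = x₀` such that for every `λ ∈ Δ` one has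
`‖g λ − x₀‖ ≤ δ` and `F (g λ, λ) = 0`, and every solution of `F (x, λ) = 0` with `λ ∈ Δ` and
`‖x − x₀‖ ≤ δ` satisfies `x = g λ`.  Here `Δ` is the closed ball of radius
`δ₁ = min δ (δ / (2Υ))` around `λ₀`. -/
theorem quantitative_implicit_function_existence_uniqueness
    {𝓑 𝓟 : Type*} [NormedAddCommGroup 𝓑] [NormedSpace ℝ 𝓑] [CompleteSpace 𝓑]
    [NormedAddCommGroup 𝓟] [NormedSpace ℝ 𝓟] [CompleteSpace 𝓟]
    (F : 𝓑 × 𝓟 → 𝓑) (hFcont : Continuous F)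
    (DF : 𝓑 × 𝓟 → (𝓑 × 𝓟 →L[ℝ] 𝓑))
    (hDF : ∀ p : 𝓑 × 𝓟, HasFDerivAt F (DF p) p)
    (x₀ : 𝓑) (lam₀ : 𝓟) (hF₀ : F (x₀, lam₀) = 0)
    (A₀ : 𝓑 ≃L[ℝ] 𝓑)
    (hA₀ : (A₀ : 𝓑 →L[ℝ] 𝓑)
      = (DF (x₀, lam₀)).comp (ContinuousLinearMap.inl ℝ 𝓑 𝓟))
    (δ Υ : ℝ) (hδ : 0 < δ) (hΥ : 0 < Υ)
    (hx : ∀ x : 𝓑, ∀ lam : 𝓟, ‖x - x₀‖ ≤ δ → ‖lam - lam₀‖ ≤ δ →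
      ‖ContinuousLinearMap.id ℝ 𝓑 -
        (A₀.symm : 𝓑 →L[ℝ] 𝓑).comp
          ((DF (x, lam)).comp (ContinuousLinearMap.inl ℝ 𝓑 𝓟))‖ ≤ 1 / 2)
    (hlam : ∀ x : 𝓑, ∀ lam : 𝓟, ‖x - x₀‖ ≤ δ → ‖lam - lam₀‖ ≤ δ →
      ‖(A₀.symm : 𝓑 →L[ℝ] 𝓑).comp
          ((DF (x, lam)).comp (ContinuousLinearMap.inr ℝ 𝓑 𝓟))‖ ≤ Υ) :
    ∃ g : 𝓟 → 𝓑,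
      ContinuousOn g (closedBall lam₀ (min δ (δ / (2 * Υ)))) ∧
      g lam₀ = x₀ ∧
      (∀ lam ∈ closedBall lam₀ (min δ (δ / (2 * Υ))),
        ‖g lam - x₀‖ ≤ δ ∧ F (g lam, lam) = 0) ∧
      (∀ lam ∈ closedBall lam₀ (min δ (δ / (2 * Υ))), ∀ x : 𝓑,
        ‖x - x₀‖ ≤ δ → F (x, lam) = 0 → x = g lam) := by
  set T : 𝓟 → 𝓑 → 𝓑 := fun l x => x - A₀.symm (F (x, l)) with hT
  have hTfix : ∀ l x, T l x = x ↔ F (x, l) = 0 := by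
    intro l x
    simp [hT]
  have hTx : ∀ l, ‖l - lam₀‖ ≤ δ → ∀ x y, ‖x - x₀‖ ≤ δ → ‖y - x₀‖ ≤ δ →
      ‖T l x - T l y‖ ≤ 1 / 2 * ‖x - y‖ := by
    intro l hl x y hxx hyy
    refine (convex_closedBall x₀ δ).norm_image_sub_le_of_norm_hasFDerivWithin_le
      (𝕜 := ℝ) (f := T l) (f' := fun z => ContinuousLinearMap.id ℝ 𝓑 -
        (A₀.symm : 𝓑 →L[ℝ] 𝓑).comp
          ((DF (z, l)).comp (ContinuousLinearMap.inl ℝ 𝓑 𝓟))) ?_ ?_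
      (by simpa [dist_eq_norm] using hyy) (by simpa [dist_eq_norm] using hxx)
    · intro z _
      have h1 : HasFDerivAt (fun z : 𝓑 => F (z, l))
          ((DF (z, l)).comp (ContinuousLinearMap.inl ℝ 𝓑 𝓟)) z :=
        (hDF (z, l)).comp z (hasFDerivAt_prodMk_left z l)
      exact ((hasFDerivAt_id z).sub
        ((A₀.symm : 𝓑 →L[ℝ] 𝓑).hasFDerivAt.comp z h1)).hasFDerivWithinAt
    · intro z hz
      exact hx z l (by simpa [dist_eq_norm] using hz) hl
  have hTl : ∀ x, ‖x - x₀‖ ≤ δ → ∀ l m, ‖l - lam₀‖ ≤ δ → ‖m - lam₀‖ ≤ δ →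
      ‖T l x - T m x‖ ≤ Υ * ‖l - m‖ := by
    intro x hxx l m hl hm
    have key := (convex_closedBall lam₀ δ).norm_image_sub_le_of_norm_hasFDerivWithin_le
      (𝕜 := ℝ) (f := fun l => A₀.symm (F (x, l))) (f' := fun l =>
        (A₀.symm : 𝓑 →L[ℝ] 𝓑).comp
          ((DF (x, l)).comp (ContinuousLinearMap.inr ℝ 𝓑 𝓟))) (C := Υ) (x := l) (y := m) ?_ ?_
      (by simpa [dist_eq_norm] using hl) (by simpa [dist_eq_norm] using hm)
    · have e : T l x - T m x = A₀.symm (F (x, m)) - A₀.symm (F (x, l)) := by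
        simp only [hT]; abel
      rw [e, norm_sub_rev l m]
      exact key
    · intro z _
      have h1 : HasFDerivAt (fun z : 𝓟 => F (x, z))
          ((DF (x, z)).comp (ContinuousLinearMap.inr ℝ 𝓑 𝓟)) z :=
        (hDF (x, z)).comp z (hasFDerivAt_prodMk_right x z)
      exact ((A₀.symm : 𝓑 →L[ℝ] 𝓑).hasFDerivAt.comp z h1).hasFDerivWithinAt
    · intro z hz
      exact hlam x z hxx (by simpa [dist_eq_norm] using hz)
  have hx₀ : ‖x₀ - x₀‖ ≤ δ := by simpa using hδ.le
  have hl₀ : ‖lam₀ - lam₀‖ ≤ δ := by simpa using hδ.le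
  have hball : ∀ l ∈ closedBall lam₀ (min δ (δ / (2 * Υ))),
      ‖l - lam₀‖ ≤ δ ∧ Υ * ‖l - lam₀‖ ≤ δ / 2 := by
    intro l hl
    rw [mem_closedBall, dist_eq_norm, le_min_iff] at hl
    refine ⟨hl.1, ?_⟩
    have := (le_div_iff₀ (by positivity)).1 hl.2
    linarith
  have huniq : ∀ l, ‖l - lam₀‖ ≤ δ → ∀ x y, ‖x - x₀‖ ≤ δ → ‖y - x₀‖ ≤ δ →
      F (x, l) = 0 → F (y, l) = 0 → x = y := by
    intro l hl x y h1 h2 h3 h4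
    have h := hTx l hl x y h1 h2
    rw [(hTfix l x).2 h3, (hTfix l y).2 h4] at h
    have h0 : ‖x - y‖ ≤ 0 := by linarith
    exact sub_eq_zero.1 (norm_le_zero_iff.1 h0)
  have hex : ∀ l, ∃ x, l ∈ closedBall lam₀ (min δ (δ / (2 * Υ))) →
      ‖x - x₀‖ ≤ δ ∧ F (x, l) = 0 := by
    intro l
    by_cases hl : l ∈ closedBall lam₀ (min δ (δ / (2 * Υ)))
    swap
    · exact ⟨x₀, fun h => absurd h hl⟩
    obtain ⟨h1, h2⟩ := hball l hl
    have hmaps : Set.MapsTo (T l) (closedBall x₀ δ) (closedBall x₀ δ) := by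
      intro x hxm
      rw [mem_closedBall, dist_eq_norm] at hxm ⊢
      have ha := hTx l h1 x x₀ hxm hx₀
      have hb := hTl x₀ hx₀ l lam₀ h1 hl₀
      rw [(hTfix lam₀ x₀).2 hF₀] at hb
      have hc := norm_sub_le_norm_sub_add_norm_sub (T l x) (T l x₀) x₀
      linarith
    have hcontr : ContractingWith (1 / 2) (hmaps.restrict (T l) _ _) := by
      refine ⟨by rw [← NNReal.coe_lt_coe]; norm_num, LipschitzWith.of_dist_le_mul ?_⟩
      rintro ⟨x, hxm⟩ ⟨y, hym⟩
      rw [mem_closedBall, dist_eq_norm] at hxm hym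
      have := hTx l h1 x y hxm hym
      simpa [Subtype.dist_eq, dist_eq_norm] using this
    obtain ⟨y, hy, hfix, -⟩ := hcontr.exists_fixedPoint' isClosed_closedBall.isComplete hmaps
      (mem_closedBall_self hδ.le) (edist_ne_top x₀ _)
    refine ⟨y, fun _ => ⟨by simpa [dist_eq_norm] using hy, (hTfix l y).1 hfix⟩⟩
  choose g hg using hex
  refine ⟨g, ?_, ?_, hg, ?_⟩
  · have : LipschitzOnWith (Real.toNNReal (2 * Υ)) g
        (closedBall lam₀ (min δ (δ / (2 * Υ)))) := by
      refine LipschitzOnWith.of_dist_le_mul ?_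
      intro l hl m hm
      rw [Real.coe_toNNReal _ (by positivity), dist_eq_norm, dist_eq_norm]
      have ha := hTx l (hball l hl).1 (g l) (g m) (hg l hl).1 (hg m hm).1
      have hb := hTl (g m) (hg m hm).1 l m (hball l hl).1 (hball m hm).1
      rw [(hTfix l (g l)).2 (hg l hl).2] at ha
      rw [(hTfix m (g m)).2 (hg m hm).2] at hb
      have hc := norm_sub_le_norm_sub_add_norm_sub (g l) (T l (g m)) (g m)
      linarith
    exact this.continuousOn
  · have hm : lam₀ ∈ closedBall lam₀ (min δ (δ / (2 * Υ))) :=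
      mem_closedBall_self (by positivity)
    exact huniq lam₀ hl₀ _ _ (hg lam₀ hm).1 hx₀ (hg lam₀ hm).2 hF₀
  · intro l hl x h1 h2
    exact huniq l (hball l hl).1 _ _ h1 (hg l hl).1 h2 (hg l hl).2
end

section
/- Any map g : Δ → 𝓑 satisfying ‖g(λ) − x₀‖ ≤ δ and F(g(λ), λ) = 0 for all λ ∈ Δ is Lipschitz continuous with constant 2Υ, i.e. ‖g(λ) − g(λ')‖ ≤ 2Υ‖λ − λ'‖ for all λ, λ' ∈ Δ. (Lipschitz continuity of the implicit function, from the proof of Theorem A.1.) -/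
open Metric

/-- **Lipschitz continuity of the implicit function** (from the proof of Theorem A.1).
Any map `g : Δ → 𝓑` satisfying `‖g λ − x₀‖ ≤ δ` and `F (g λ, λ) = 0` for all `λ ∈ Δ` is
Lipschitz with constant `2Υ`:  `‖g λ − g λ'‖ ≤ 2Υ ‖λ − λ'‖` for all `λ, λ' ∈ Δ`, where
`Δ` is the closed ball of radius `δ₁ = min δ (δ / (2Υ))` around `λ₀`. -/
theorem implicit_function_lipschitz
    {𝓑 𝓟 : Type*} [NormedAddCommGroup 𝓑] [NormedSpace ℝ 𝓑] [CompleteSpace 𝓑]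
    [NormedAddCommGroup 𝓟] [NormedSpace ℝ 𝓟] [CompleteSpace 𝓟]
    (F : 𝓑 × 𝓟 → 𝓑) (hFcont : Continuous F)
    (DF : 𝓑 × 𝓟 → (𝓑 × 𝓟 →L[ℝ] 𝓑))
    (hDF : ∀ p : 𝓑 × 𝓟, HasFDerivAt F (DF p) p)
    (x₀ : 𝓑) (lam₀ : 𝓟) (hF₀ : F (x₀, lam₀) = 0)
    (A₀ : 𝓑 ≃L[ℝ] 𝓑)
    (hA₀ : (A₀ : 𝓑 →L[ℝ] 𝓑)
      = (DF (x₀, lam₀)).comp (ContinuousLinearMap.inl ℝ 𝓑 𝓟))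
    (δ Υ : ℝ) (hδ : 0 < δ) (hΥ : 0 < Υ)
    (hx : ∀ x : 𝓑, ∀ lam : 𝓟, ‖x - x₀‖ ≤ δ → ‖lam - lam₀‖ ≤ δ →
      ‖ContinuousLinearMap.id ℝ 𝓑 -
        (A₀.symm : 𝓑 →L[ℝ] 𝓑).comp
          ((DF (x, lam)).comp (ContinuousLinearMap.inl ℝ 𝓑 𝓟))‖ ≤ 1 / 2)
    (hlam : ∀ x : 𝓑, ∀ lam : 𝓟, ‖x - x₀‖ ≤ δ → ‖lam - lam₀‖ ≤ δ →
      ‖(A₀.symm : 𝓑 →L[ℝ] 𝓑).comp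
          ((DF (x, lam)).comp (ContinuousLinearMap.inr ℝ 𝓑 𝓟))‖ ≤ Υ)
    (g : 𝓟 → 𝓑)
    (hg : ∀ lam ∈ closedBall lam₀ (min δ (δ / (2 * Υ))),
      ‖g lam - x₀‖ ≤ δ ∧ F (g lam, lam) = 0) :
    ∀ lam ∈ closedBall lam₀ (min δ (δ / (2 * Υ))),
      ∀ lam' ∈ closedBall lam₀ (min δ (δ / (2 * Υ))),
        ‖g lam - g lam'‖ ≤ 2 * Υ * ‖lam - lam'‖ := by
  intro a ha b hb
  obtain ⟨ga, Fa⟩ := hg a ha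
  obtain ⟨gb, Fb⟩ := hg b hb
  have ha' : ‖a - lam₀‖ ≤ δ := by
    rw [← dist_eq_norm]; exact (mem_closedBall.1 ha).trans (min_le_left _ _)
  have hb' : ‖b - lam₀‖ ≤ δ := by
    rw [← dist_eq_norm]; exact (mem_closedBall.1 hb).trans (min_le_left _ _)
  have h1 : ‖(g a - A₀.symm (F (g a, a))) - (g b - A₀.symm (F (g b, a)))‖
      ≤ 1 / 2 * ‖g a - g b‖ := by
    refine (convex_closedBall x₀ δ).norm_image_sub_le_of_norm_hasFDerivWithin_le
      (f := fun x => x - A₀.symm (F (x, a)))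
      (f' := fun x => ContinuousLinearMap.id ℝ 𝓑 - (A₀.symm : 𝓑 →L[ℝ] 𝓑).comp
          ((DF (x, a)).comp (ContinuousLinearMap.inl ℝ 𝓑 𝓟))) ?_ ?_ ?_ ?_
    · intro x _
      have h := HasFDerivAt.comp (g := F) (f := fun e : 𝓑 => (e, a)) x (hDF (x, a))
        (hasFDerivAt_prodMk_left x a)
      exact ((hasFDerivAt_id x).sub
        ((A₀.symm : 𝓑 →L[ℝ] 𝓑).hasFDerivAt.comp x h)).hasFDerivWithinAt
    · intro x hxm
      exact hx x a (by rw [← dist_eq_norm]; exact hxm) ha'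
    · exact mem_closedBall.2 (by rw [dist_eq_norm]; exact gb)
    · exact mem_closedBall.2 (by rw [dist_eq_norm]; exact ga)
  have h2 : ‖A₀.symm (F (g b, a)) - A₀.symm (F (g b, b))‖ ≤ Υ * ‖a - b‖ := by
    refine (convex_closedBall lam₀ δ).norm_image_sub_le_of_norm_hasFDerivWithin_le
      (f := fun l => A₀.symm (F (g b, l)))
      (f' := fun l => (A₀.symm : 𝓑 →L[ℝ] 𝓑).comp
          ((DF (g b, l)).comp (ContinuousLinearMap.inr ℝ 𝓑 𝓟))) ?_ ?_ ?_ ?_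
    · intro l _
      have h := HasFDerivAt.comp (g := F) (f := fun e : 𝓟 => (g b, e)) l (hDF (g b, l))
        (hasFDerivAt_prodMk_right (g b) l)
      exact ((A₀.symm : 𝓑 →L[ℝ] 𝓑).hasFDerivAt.comp l h).hasFDerivWithinAt
    · intro l hl
      exact hlam (g b) l gb (by rw [← dist_eq_norm]; exact hl)
    · exact mem_closedBall.2 (by rw [dist_eq_norm]; exact hb')
    · exact mem_closedBall.2 (by rw [dist_eq_norm]; exact ha')
  rw [Fa, map_zero, sub_zero] at h1
  rw [Fb, map_zero, sub_zero] at h2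
  have h3 : g a - g b = (g a - (g b - A₀.symm (F (g b, a)))) - A₀.symm (F (g b, a)) := by abel
  have h4 := norm_sub_le (g a - (g b - A₀.symm (F (g b, a)))) (A₀.symm (F (g b, a)))
  rw [← h3] at h4
  linarith
end

section
/- There exists a unique h ∈ X with L h = h and ℓ(h) = 1; the fixed-point set {x ∈ X : L x = x} equals the one-dimensional span of h (so 1 is a simple eigenvalue of L); and every z in the spectrum of L satisfies either z = 1 or |z| ≤ ϑ. (Abstract form of the spectral gap statement of Lemma 2.2.) -/
/-- Neumann series: `z - L` is onto on the hyperplane `ker ℓ` when `ϑ < ‖z‖`. -/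
lemma exists_resolvent_on_hyperplane
    {X : Type*} [NormedAddCommGroup X] [NormedSpace ℂ X] [CompleteSpace X]
    (L : X →L[ℂ] X) (ℓ : X →L[ℂ] ℂ)
    (hinv : ∀ x : X, ℓ (L x) = ℓ x)
    (ϑ : ℝ) (hϑ0 : 0 < ϑ) (nbar : ℕ)
    (hcontr : ∀ n : ℕ, nbar ≤ n → ∀ x : X, ℓ x = 0 → ‖(L ^ n) x‖ ≤ ϑ ^ n * ‖x‖)
    (z : ℂ) (hz : ϑ < ‖z‖) (y : X) (hy : ℓ y = 0) :
    ∃ v : X, ℓ v = 0 ∧ z • v - L v = y := by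
  have hzn : 0 < ‖z‖ := hϑ0.trans hz
  have hz0 : z ≠ 0 := norm_pos_iff.mp hzn
  have hpow : ∀ n : ℕ, ℓ ((L ^ n) y) = 0 := by
    intro n
    induction n with
    | zero => simpa using hy
    | succ k ih => rw [pow_succ', mul_apply_eq_comp, hinv, ih]
  let a : ℕ → X := fun n => (z⁻¹) ^ n • (L ^ n) y
  have hgeo : Summable (fun n : ℕ => (ϑ / ‖z‖) ^ n * ‖y‖) :=
    (summable_geometric_of_lt_one (by positivity) ((div_lt_one hzn).2 hz)).mul_right _
  have ha : Summable a := by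
    refine Summable.of_norm_bounded_eventually_nat hgeo ?_
    filter_upwards [Filter.eventually_ge_atTop nbar] with n hn
    have h1 := hcontr n hn y hy
    simp only [a, norm_smul, norm_pow, norm_inv]
    calc ‖z‖⁻¹ ^ n * ‖(L ^ n) y‖ ≤ ‖z‖⁻¹ ^ n * (ϑ ^ n * ‖y‖) := by gcongr
      _ = (ϑ / ‖z‖) ^ n * ‖y‖ := by rw [div_eq_mul_inv, mul_pow]; ring
  have hLa : ∀ n, L (a n) = z • a (n + 1) := by
    intro n
    simp only [a, map_smul, smul_smul]
    rw [pow_succ' L, mul_apply_eq_comp, pow_succ', ← mul_assoc,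
      mul_inv_cancel₀ hz0, one_mul]
  have hsum : L (∑' n, a n) = z • ∑' n, a (n + 1) := by
    rw [ContinuousLinearMap.map_tsum L ha]
    simp only [hLa]
    exact ((summable_nat_add_iff 1).2 ha).tsum_const_smul z
  have hl : ℓ (∑' n, a n) = 0 := by
    rw [ContinuousLinearMap.map_tsum ℓ ha]
    simp only [a, map_smul, hpow, smul_zero, tsum_zero]
  have h0 : ∑' n, a n = y + ∑' n, a (n + 1) := by
    rw [ha.tsum_eq_zero_add]; simp [a]
  refine ⟨z⁻¹ • ∑' n, a n, by simp [hl], ?_⟩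
  rw [map_smul, hsum, smul_smul, smul_smul, mul_inv_cancel₀ hz0, inv_mul_cancel₀ hz0,
    one_smul, one_smul, h0]
  simp

/-- `z - L` is injective on the hyperplane when `ϑ < ‖z‖`. -/
lemma eq_zero_of_eigen_on_hyperplane
    {X : Type*} [NormedAddCommGroup X] [NormedSpace ℂ X]
    (L : X →L[ℂ] X) (ℓ : X →L[ℂ] ℂ)
    (ϑ : ℝ) (hϑ0 : 0 < ϑ) (nbar : ℕ)
    (hcontr : ∀ n : ℕ, nbar ≤ n → ∀ x : X, ℓ x = 0 → ‖(L ^ n) x‖ ≤ ϑ ^ n * ‖x‖)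
    (z : ℂ) (hz : ϑ < ‖z‖) (x : X) (hx : ℓ x = 0) (hLx : L x = z • x) : x = 0 := by
  have hpow : ∀ n : ℕ, (L ^ n) x = z ^ n • x := by
    intro n
    induction n with
    | zero => simp
    | succ k ih => rw [pow_succ', mul_apply_eq_comp, ih, map_smul, hLx, smul_smul,
        pow_succ]
  have h1 := hcontr (nbar + 1) (by omega) x hx
  rw [hpow, norm_smul, norm_pow] at h1
  have h2 : ϑ ^ (nbar + 1) < ‖z‖ ^ (nbar + 1) := pow_lt_pow_left₀ hz hϑ0.le (by omega)
  by_contra hne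
  have h3 : 0 < ‖x‖ := norm_pos_iff.mpr hne
  nlinarith

/-- **Abstract spectral gap statement (Lemma 2.2).**  Let `X` be a nonzero complex Banach
space, `L` a bounded operator on `X` and `ℓ` a nonzero continuous linear functional with
`ℓ (L x) = ℓ x` for all `x`, and suppose that for some `ϑ ∈ (0,1)` and `nbar ∈ ℕ` one has
`‖Lⁿ x‖ ≤ ϑⁿ ‖x‖` for all `n ≥ nbar` and all `x ∈ ker ℓ`.  Then there is a unique `h` with
`L h = h` and `ℓ h = 1`; the fixed-point set of `L` is the span of `h` (so `1` is a simple
eigenvalue); and every spectral value `z` of `L` satisfies `z = 1` or `‖z‖ ≤ ϑ`. -/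
theorem spectral_gap_of_uniform_contraction_on_hyperplane
    {X : Type*} [NormedAddCommGroup X] [NormedSpace ℂ X] [CompleteSpace X] [Nontrivial X]
    (L : X →L[ℂ] X) (ℓ : X →L[ℂ] ℂ) (hℓ : ℓ ≠ 0)
    (hinv : ∀ x : X, ℓ (L x) = ℓ x)
    (ϑ : ℝ) (hϑ0 : 0 < ϑ) (hϑ1 : ϑ < 1) (nbar : ℕ)
    (hcontr : ∀ n : ℕ, nbar ≤ n → ∀ x : X, ℓ x = 0 → ‖(L ^ n) x‖ ≤ ϑ ^ n * ‖x‖) :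
    ∃ h : X, L h = h ∧ ℓ h = 1 ∧
      (∀ h' : X, L h' = h' → ℓ h' = 1 → h' = h) ∧
      {x : X | L x = x} = (Submodule.span ℂ {h} : Submodule ℂ X) ∧
      (∀ z ∈ spectrum ℂ L, z = 1 ∨ ‖z‖ ≤ ϑ) := by
  have hone : ϑ < ‖(1 : ℂ)‖ := by simpa using hϑ1
  obtain ⟨x₁, hx₁⟩ : ∃ x, ℓ x ≠ 0 := by
    by_contra! hc
    exact hℓ (ContinuousLinearMap.ext hc)
  obtain ⟨x₀, hx₀⟩ : ∃ x, ℓ x = 1 := ⟨(ℓ x₁)⁻¹ • x₁, by simp [hx₁]⟩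
  obtain ⟨v, hv, hvL⟩ := exists_resolvent_on_hyperplane L ℓ hinv ϑ hϑ0 nbar hcontr 1 hone
    (L x₀ - x₀) (by simp [hinv])
  have hfix : L (x₀ + v) = x₀ + v := by
    rw [one_smul] at hvL
    have h1 : L x₀ = v - L v + x₀ := by rw [hvL]; abel
    rw [map_add, h1]
    abel
  have hlh : ℓ (x₀ + v) = 1 := by simp [hx₀, hv]
  generalize x₀ + v = h at hfix hlh
  have hspan : ∀ x, L x = x → x = ℓ x • h := by
    intro x hx
    rw [← sub_eq_zero]
    exact eq_zero_of_eigen_on_hyperplane L ℓ ϑ hϑ0 nbar hcontr 1 hone _ (by simp [hlh])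
      (by simp [hx, hfix])
  refine ⟨h, hfix, hlh, ?_, ?_, ?_⟩
  · intro h' h1 h2
    rw [hspan h' h1, h2, one_smul]
  · ext x
    simp only [Set.mem_ofPred_eq, SetLike.mem_coe, Submodule.mem_span_singleton]
    constructor
    · intro hx
      exact ⟨ℓ x, (hspan x hx).symm⟩
    · rintro ⟨c, rfl⟩
      rw [map_smul, hfix]
  · intro z hzs
    by_contra! hc
    obtain ⟨hz1, hz⟩ := hc
    apply spectrum.mem_iff.1 hzs
    have happ : ∀ x, (algebraMap ℂ (X →L[ℂ] X) z - L) x = z • x - L x := by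
      intro x
      simp [Algebra.algebraMap_eq_smul_one]
    rw [ContinuousLinearMap.isUnit_iff_bijective]
    constructor
    · rw [injective_iff_map_eq_zero]
      intro x hx
      rw [happ, sub_eq_zero] at hx
      refine eq_zero_of_eigen_on_hyperplane L ℓ ϑ hϑ0 nbar hcontr z hz x ?_ hx.symm
      have h1 := congrArg ℓ hx
      rw [hinv, map_smul, smul_eq_mul] at h1
      have h2 : (z - 1) * ℓ x = 0 := by linear_combination h1
      exact (mul_eq_zero.1 h2).resolve_left (sub_ne_zero.2 hz1)
    · intro y
      obtain ⟨w, -, hw⟩ := exists_resolvent_on_hyperplane L ℓ hinv ϑ hϑ0 nbar hcontr z hz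
        (y - ℓ y • h) (by simp [hlh])
      refine ⟨(ℓ y / (z - 1)) • h + w, ?_⟩
      have hz2 : z - 1 ≠ 0 := sub_ne_zero.2 hz1
      have h3 : z • (ℓ y / (z - 1)) • h - (ℓ y / (z - 1)) • h = ℓ y • h := by
        rw [smul_smul, ← sub_smul]
        congr 1
        field_simp
      rw [happ, map_add, map_smul, hfix, smul_add, add_sub_add_comm, hw, h3]
      abel
end

section
/- For every z ∈ ℂ not in the spectrum of L: z belongs to the spectrum of D if and only if Z((z·Id − L)⁻¹ w) = 1; and in that case φ := (z·Id − L)⁻¹ w is a nonzero vector with D φ = z φ, and the eigenspace {ψ : D ψ = z ψ} equals the one-dimensional span of φ. (Core eigenvalue criterion of Proposition 5.3: z ∈ σ(𝒟) \ σ(L) iff Ξ(z) = 1.) -/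
/-- **Eigenvalue criterion for a rank-one perturbation (core of Proposition 5.3).**
Let `L` be a bounded operator on a complex Banach space `X`, `w ∈ X`, `Z` a continuous
linear functional, and `D φ := L φ + Z φ • w`.  For every `z ∉ σ(L)`:
`z ∈ σ(D)` iff `Z ((z·Id − L)⁻¹ w) = 1`, and in that case `φ := (z·Id − L)⁻¹ w` is a nonzero
eigenvector of `D` with eigenvalue `z`, whose eigenspace is exactly the span of `φ`. -/
theorem rankOne_perturbation_spectrum_criterion
    {X : Type*} [NormedAddCommGroup X] [NormedSpace ℂ X] [CompleteSpace X]
    (L : X →L[ℂ] X) (w : X) (Z : X →L[ℂ] ℂ)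
    (D : X →L[ℂ] X) (hD : ∀ φ : X, D φ = L φ + Z φ • w) :
    ∀ z : ℂ, z ∉ spectrum ℂ L →
      ((z ∈ spectrum ℂ D ↔
          Z ((Ring.inverse (algebraMap ℂ (X →L[ℂ] X) z - L)) w) = 1) ∧
       (Z ((Ring.inverse (algebraMap ℂ (X →L[ℂ] X) z - L)) w) = 1 →
          (Ring.inverse (algebraMap ℂ (X →L[ℂ] X) z - L)) w ≠ 0 ∧
          D ((Ring.inverse (algebraMap ℂ (X →L[ℂ] X) z - L)) w)
            = z • ((Ring.inverse (algebraMap ℂ (X →L[ℂ] X) z - L)) w) ∧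
          {ψ : X | D ψ = z • ψ}
            = (Submodule.span ℂ
                {(Ring.inverse (algebraMap ℂ (X →L[ℂ] X) z - L)) w} : Submodule ℂ X))) := by
  intro z hz
  have hu : IsUnit (algebraMap ℂ (X →L[ℂ] X) z - L) := spectrum.notMem_iff.mp hz
  have e1 := Ring.mul_inverse_cancel _ hu
  have e2 := Ring.inverse_mul_cancel _ hu
  generalize Ring.inverse (algebraMap ℂ (X →L[ℂ] X) z - L) = R at e1 e2 ⊢
  have h1 : ∀ x, z • R x - L (R x) = x := fun x => by
    simpa [Algebra.algebraMap_eq_smul_one] using congrArg (fun T : X →L[ℂ] X => T x) e1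
  have h2 : ∀ x, z • R x - R (L x) = x := fun x => by
    simpa [Algebra.algebraMap_eq_smul_one] using congrArg (fun T : X →L[ℂ] X => T x) e2
  have main : Z (R w) = 1 → R w ≠ 0 ∧ D (R w) = z • R w := by
    intro h
    refine ⟨fun h0 => by simp [h0] at h, ?_⟩
    rw [hD, h, one_smul]
    nth_rewrite 2 [← h1 w]
    abel
  refine ⟨⟨fun hs => ?_, fun h => ?_⟩, fun h => ⟨(main h).1, (main h).2, ?_⟩⟩
  · by_contra hne
    apply hs
    have hc : (1 - Z (R w)) ≠ 0 := sub_ne_zero.mpr (Ne.symm hne)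
    obtain ⟨c, hcc⟩ : ∃ c : ℂ, c * (1 - Z (R w)) = 1 := ⟨_, inv_mul_cancel₀ hc⟩
    let S : X →L[ℂ] X := R + (c • (Z.comp R)).smulRight (R w)
    have hS : ∀ x, S x = R x + (c * Z (R x)) • R w := fun x => by simp [S]
    refine ⟨⟨algebraMap ℂ (X →L[ℂ] X) z - D, S, ?_, ?_⟩, rfl⟩
    · ext x
      have : z • S x - D (S x) = x := by
        rw [hD, hS]
        simp only [map_add, map_smul, smul_eq_mul]
        have a := h1 x
        have b := h1 w
        calc _ = (z • R x - L (R x)) + (c * Z (R x)) • (z • R w - L (R w))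
              - (Z (R x) + c * Z (R x) * Z (R w)) • w := by module
          _ = x + (Z (R x) * (c * (1 - Z (R w)) - 1)) • w := by rw [a, b]; module
          _ = x := by rw [hcc]; simp
      simpa [Algebra.algebraMap_eq_smul_one] using this
    · ext x
      have : S (z • x - D x) = x := by
        have hR : R (z • x - D x) = x - Z x • R w := by
          rw [hD]
          simp only [map_add, map_sub, map_smul]
          rw [← sub_sub, h2 x]
        rw [hS, hR]
        simp only [map_sub, map_smul, smul_eq_mul]
        calc _ = x + (Z x * (c * (1 - Z (R w)) - 1)) • R w := by module
          _ = x := by rw [hcc]; simp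
      simpa [Algebra.algebraMap_eq_smul_one] using this
  · intro hU
    obtain ⟨hn, he⟩ := main h
    have e3 := Ring.inverse_mul_cancel _ (show IsUnit (algebraMap ℂ (X →L[ℂ] X) z - D) from hU)
    generalize Ring.inverse (algebraMap ℂ (X →L[ℂ] X) z - D) = T at e3
    apply hn
    have h3 := congrArg (fun T : X →L[ℂ] X => T (R w)) e3
    have h4 : (algebraMap ℂ (X →L[ℂ] X) z - D) (R w) = 0 := by
      simp [Algebra.algebraMap_eq_smul_one, he]
    have h5 : T ((algebraMap ℂ (X →L[ℂ] X) z - D) (R w)) = R w := h3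
    rw [← h5, h4, map_zero]
  · ext ψ
    simp only [Set.mem_setOf_eq, SetLike.mem_coe, Submodule.mem_span_singleton]
    constructor
    · intro hψ
      refine ⟨Z ψ, ?_⟩
      have h6 := congrArg R hψ
      rw [hD] at h6
      simp only [map_add, map_smul] at h6
      rw [← sub_eq_iff_eq_add'.mpr h6.symm, h2]
    · rintro ⟨a, rfl⟩
      rw [map_smul, (main h).2, smul_comm]
end

section
/- The map which sends a Borel probability measure η on 𝕋^d to the pushforward (T_{ν,η})_* η is continuous from the space of Borel probability measures on 𝕋^d, equipped with the topology of weak convergence, to itself. In particular, if η_n → η weakly then (T_{ν,η_n})_* η_n → (T_{ν,η})_* η weakly. (Weak continuity of the nonlinear transfer operator, Lemma 5.4.) -/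
open MeasureTheory

/-- The mean-field coupled map `T_{ν,η}(x) = T x + π (ν (∫ α dη) β)` on the torus
`𝕋^d = (ℝ/ℤ)^d`, where `π : ℝ^d → 𝕋^d` is the quotient map applied componentwise. -/
noncomputable def coupledTorusMap (d : ℕ)
    (T : (Fin d → AddCircle (1 : ℝ)) → (Fin d → AddCircle (1 : ℝ)))
    (α : (Fin d → AddCircle (1 : ℝ)) → ℝ) (β : Fin d → ℝ) (ν : ℝ)
    (η : Measure (Fin d → AddCircle (1 : ℝ))) :
    (Fin d → AddCircle (1 : ℝ)) → (Fin d → AddCircle (1 : ℝ)) :=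
  fun x => T x + fun i => (((ν * ∫ y, α y ∂η) * β i : ℝ) : AddCircle (1 : ℝ))

/-- Joint continuity of the pairing between continuous functions and probability measures on a
compact space, along a continuous family of functions. -/
lemma continuous_integral_family {X : Type*} [TopologicalSpace X] [CompactSpace X]
    [MeasurableSpace X] [OpensMeasurableSpace X]
    (H : ProbabilityMeasure X → C(X, ℝ)) (hH : Continuous H) :
    Continuous fun η : ProbabilityMeasure X => ∫ x, H η x ∂(η : Measure X) := by
  rw [continuous_iff_continuousAt]
  intro η₀
  have hint : ∀ (f : C(X, ℝ)) (η : ProbabilityMeasure X), Integrable f (η : Measure X) :=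
    fun f η => (BoundedContinuousFunction.mkOfCompact f).integrable _
  have h1 : Filter.Tendsto (fun η : ProbabilityMeasure X => ∫ x, H η₀ x ∂(η : Measure X))
      (nhds η₀) (nhds (∫ x, H η₀ x ∂(η₀ : Measure X))) :=
    (ProbabilityMeasure.continuous_integral_continuousMap (H η₀)).tendsto η₀
  have h2 : Filter.Tendsto
      (fun η : ProbabilityMeasure X => ∫ x, (H η - H η₀) x ∂(η : Measure X))
      (nhds η₀) (nhds 0) := by
    have h3 : Filter.Tendsto (fun η => ‖H η - H η₀‖) (nhds η₀) (nhds 0) := by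
      have := ((hH.sub continuous_const).norm (E := C(X, ℝ))).tendsto (x := η₀)
        (f := fun η => ‖H η - H η₀‖)
      simpa using this
    refine squeeze_zero_norm (fun η => ?_) h3
    have := norm_integral_le_of_norm_le_const (μ := (η : Measure X))
      (Filter.Eventually.of_forall fun x => (H η - H η₀).norm_coe_le_norm x)
    simpa using this
  have h4 := h2.add h1
  rw [zero_add] at h4
  refine h4.congr fun η => ?_
  rw [← integral_add (hint _ _) (hint _ _)]
  simp

/-- **Weak continuity of the nonlinear transfer operator (Lemma 5.4).**
The map sending a Borel probability measure `η` on `𝕋^d` to the pushforward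
`(T_{ν,η})_* η` is continuous for the topology of weak convergence; in particular it maps
weakly converging sequences to weakly converging sequences. -/
theorem coupled_transfer_operator_weakly_continuous (d : ℕ) (hd : 1 ≤ d)
    (T : (Fin d → AddCircle (1 : ℝ)) → (Fin d → AddCircle (1 : ℝ))) (hT : Continuous T)
    (α : (Fin d → AddCircle (1 : ℝ)) → ℝ) (hα : Continuous α)
    (β : Fin d → ℝ) (ν : ℝ)
    (Φ : ProbabilityMeasure (Fin d → AddCircle (1 : ℝ)) →
          ProbabilityMeasure (Fin d → AddCircle (1 : ℝ)))
    (hΦ : ∀ η : ProbabilityMeasure (Fin d → AddCircle (1 : ℝ)),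
      (Φ η : Measure (Fin d → AddCircle (1 : ℝ)))
        = Measure.map (coupledTorusMap d T α β ν (η : Measure (Fin d → AddCircle (1 : ℝ)))) η) :
    Continuous Φ ∧
    ∀ (ηs : ℕ → ProbabilityMeasure (Fin d → AddCircle (1 : ℝ)))
      (η : ProbabilityMeasure (Fin d → AddCircle (1 : ℝ))),
      Filter.Tendsto ηs Filter.atTop (nhds η) →
      Filter.Tendsto (fun n => Φ (ηs n)) Filter.atTop (nhds (Φ η)) := by
  have hc : Continuous Φ := by
    rw [ProbabilityMeasure.continuous_iff_forall_continuousMap_continuous_integral]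
    intro f
    have hS : Continuous fun p : ℝ × (Fin d → AddCircle (1 : ℝ)) =>
        f (T p.2 + fun i => (((ν * p.1) * β i : ℝ) : AddCircle (1 : ℝ))) := by
      refine f.continuous.comp ((hT.comp continuous_snd).add (continuous_pi fun i => ?_))
      exact (AddCircle.continuous_mk' (1 : ℝ)).comp (by fun_prop)
    have hα' : Continuous fun η : ProbabilityMeasure (Fin d → AddCircle (1 : ℝ)) =>
        ∫ y, α y ∂(η : Measure (Fin d → AddCircle (1 : ℝ))) :=
      ProbabilityMeasure.continuous_integral_continuousMap (⟨α, hα⟩ : C(_, ℝ))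
    have key := continuous_integral_family _
      ((ContinuousMap.curry ⟨_, hS⟩).continuous.comp hα')
    refine key.congr fun η => ?_
    have hm : Continuous (coupledTorusMap d T α β ν
        (η : Measure (Fin d → AddCircle (1 : ℝ)))) := hT.add continuous_const
    rw [hΦ, integral_map hm.measurable.aemeasurable f.continuous.aestronglyMeasurable]
    rfl
  exact ⟨hc, fun ηs η h => (hc.tendsto η).comp h⟩
end

section
/- Let X be a compact metric space with its Borel σ-algebra, m and μ Borel probability measures on X, T : X → X Borel measurable, and σ : X → X a homeomorphism such that σ_* m = m and σ ∘ T = T ∘ σ. Assume that for every Borel probability measure η absolutely continuous with respect to m, the pushforwards (Tⁿ)_* η converge weakly to μ as n → ∞. Then σ_* μ = μ. (Abstract form of the lemma in Section 6.2 stating that the SRB measure is exchangeable.) -/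
open MeasureTheory

/-- **The physical (SRB) measure is exchangeable (abstract form, Section 6.2).**
Let `X` be a compact metric space, `m` and `μ` Borel probability measures, `T` Borel
measurable, and `σ` a homeomorphism with `σ_* m = m` and `σ ∘ T = T ∘ σ`.  If the pushforwards
`(Tⁿ)_* η` converge weakly to `μ` for every Borel probability measure `η ≪ m`, then
`σ_* μ = μ`. -/
theorem pushforward_limit_measure_invariant_under_symmetry
    {X : Type*} [MetricSpace X] [CompactSpace X] [MeasurableSpace X] [BorelSpace X]
    (m μ : Measure X) [IsProbabilityMeasure m] [IsProbabilityMeasure μ]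
    (T : X → X) (hT : Measurable T)
    (σ : Homeomorph X X)
    (hσm : Measure.map σ m = m)
    (hcomm : σ ∘ T = T ∘ σ)
    (hconv : ∀ η : Measure X, IsProbabilityMeasure η → η ≪ m →
      ∀ f : C(X, ℝ),
        Filter.Tendsto (fun n : ℕ => ∫ x, f x ∂(Measure.map (T^[n]) η))
          Filter.atTop (nhds (∫ x, f x ∂μ))) :
    Measure.map σ μ = μ := by
  have hσ : Measurable σ := σ.continuous.measurable
  haveI : IsProbabilityMeasure (Measure.map σ μ) :=
    Measure.isProbabilityMeasure_map hσ.aemeasurable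
  refine ext_of_forall_integral_eq_of_IsFiniteMeasure fun f => ?_
  have hcm : ∀ n : ℕ, σ ∘ T^[n] = T^[n] ∘ σ := fun n =>
    Function.Semiconj.comp_eq
      (Function.Semiconj.iterate_right (fun x => congrFun hcomm x) n)
  have hmap : ∀ n : ℕ, Measure.map σ (Measure.map (T^[n]) m) = Measure.map (T^[n]) m := by
    intro n
    rw [Measure.map_map hσ (hT.iterate n), hcm n, ← Measure.map_map (hT.iterate n) hσ, hσm]
  have hint : ∀ ν : Measure X, ∫ x, f x ∂(Measure.map σ ν) = ∫ x, f (σ x) ∂ν := fun ν =>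
    integral_map hσ.aemeasurable f.continuous.measurable.aestronglyMeasurable
  have h1 := hconv m inferInstance Measure.AbsolutelyContinuous.rfl f.toContinuousMap
  have h2 := hconv m inferInstance Measure.AbsolutelyContinuous.rfl
    ⟨fun x => f (σ x), f.continuous.comp σ.continuous⟩
  have h3 : ∀ n : ℕ, ∫ x, f (σ x) ∂(Measure.map (T^[n]) m) = ∫ x, f x ∂(Measure.map (T^[n]) m) := by
    intro n
    rw [← hint, hmap n]
  rw [hint]
  refine tendsto_nhds_unique h2 ?_
  exact h1.congr fun n => (h3 n).symm
end

section
/- There exists n₀ ∈ ℕ such that for all n ≥ n₀: (i) Aⁿ maps 𝒞₂ into 𝒞₁, i.e. Aⁿ v ∈ 𝒞₁ for every v ∈ 𝒞₂; and (ii) ‖Aⁿ v‖ ≥ 2‖v‖ for every v ∈ 𝒞₂. (Cone invariance and expansion for a hyperbolic linear map, from the proof of Lemma 6.2.) -/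
/-- **Cone invariance and expansion for a hyperbolic linear map (proof of Lemma 6.2).**
Let `λ > 1`, let `vᵘ, vˢ` be linearly independent unit vectors in `ℝ²` and `A` the linear map
with `A vᵘ = λ vᵘ`, `A vˢ = λ⁻¹ vˢ`.  With `𝒞_i = {a vᵘ + b vˢ : |b| ≤ i |a|}`, there is
`n₀` such that for all `n ≥ n₀`: `Aⁿ` maps `𝒞₂` into `𝒞₁`, and `‖Aⁿ v‖ ≥ 2 ‖v‖` for every
`v ∈ 𝒞₂`. -/
theorem hyperbolic_cone_invariance_and_expansion
    (lam : ℝ) (hlam : 1 < lam)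
    (vu vs : EuclideanSpace ℝ (Fin 2))
    (hindep : LinearIndependent ℝ ![vu, vs])
    (hvu : ‖vu‖ = 1) (hvs : ‖vs‖ = 1)
    (A : EuclideanSpace ℝ (Fin 2) →ₗ[ℝ] EuclideanSpace ℝ (Fin 2))
    (hAu : A vu = lam • vu) (hAs : A vs = lam⁻¹ • vs) :
    ∃ n₀ : ℕ, ∀ n : ℕ, n₀ ≤ n →
      (∀ v ∈ {w : EuclideanSpace ℝ (Fin 2) |
          ∃ a b : ℝ, |b| ≤ 2 * |a| ∧ w = a • vu + b • vs},
        (A ^ n) v ∈ {w : EuclideanSpace ℝ (Fin 2) |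
          ∃ a b : ℝ, |b| ≤ 1 * |a| ∧ w = a • vu + b • vs}) ∧
      (∀ v ∈ {w : EuclideanSpace ℝ (Fin 2) |
          ∃ a b : ℝ, |b| ≤ 2 * |a| ∧ w = a • vu + b • vs},
        2 * ‖v‖ ≤ ‖(A ^ n) v‖) := by
  obtain ⟨n₀, hn₀⟩ := pow_unbounded_of_one_lt 8 hlam
  refine ⟨n₀, fun n hn => ?_⟩
  have hL : 8 ≤ lam ^ n := hn₀.le.trans (pow_le_pow_right₀ hlam.le hn)
  have hAn : ∀ (w : EuclideanSpace ℝ (Fin 2)) (c : ℝ), A w = c • w →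
      (A ^ n) w = c ^ n • w := by
    intro w c hw
    clear hn hL
    induction n with
    | zero => simp
    | succ k ih =>
      rw [pow_succ, Module.End.mul_apply, hw, map_smul, ih, smul_smul, pow_succ, mul_comm]
  have hu := hAn vu lam hAu
  have hs := hAn vs lam⁻¹ hAs
  rw [inv_pow] at hs
  set L := lam ^ n with hLdef
  have hL0 : 0 < L := by linarith
  have hLi0 : 0 < L⁻¹ := inv_pos.mpr hL0
  have hLi : L⁻¹ ≤ 1 := inv_le_one_of_one_le₀ (by linarith)
  have himg : ∀ a b : ℝ, (A ^ n) (a • vu + b • vs) = (a * L) • vu + (b * L⁻¹) • vs := by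
    intro a b
    rw [map_add, map_smul, map_smul, hu, hs, smul_smul, smul_smul]
  have hb' : ∀ a b : ℝ, |b| ≤ 2 * |a| → |b * L⁻¹| ≤ 2 * |a| := by
    intro a b h
    rw [abs_mul, abs_of_pos hLi0]
    exact (mul_le_of_le_one_right (abs_nonneg b) hLi).trans h
  have ha' : ∀ a : ℝ, 8 * |a| ≤ |a * L| := by
    intro a
    rw [abs_mul, abs_of_pos hL0, mul_comm]
    exact mul_le_mul_of_nonneg_left hL (abs_nonneg a)
  constructor
  · rintro v ⟨a, b, hab, rfl⟩
    refine ⟨a * L, b * L⁻¹, ?_, himg a b⟩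
    linarith [hb' a b hab, ha' a, abs_nonneg a]
  · rintro v ⟨a, b, hab, rfl⟩
    have h1 : ‖a • vu + b • vs‖ ≤ |a| + |b| := by
      have := norm_add_le (a • vu) (b • vs)
      simpa [norm_smul, hvu, hvs] using this
    have h2 : |a * L| - |b * L⁻¹| ≤ ‖(a * L) • vu + (b * L⁻¹) • vs‖ := by
      have := norm_sub_le_norm_add ((a * L) • vu) ((b * L⁻¹) • vs)
      rwa [norm_smul, norm_smul, hvu, hvs, mul_one, mul_one, Real.norm_eq_abs,
        Real.norm_eq_abs] at this
    rw [himg]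
    linarith [hb' a b hab, ha' a, abs_nonneg a]
end

section
/- Suppose F(ν₀, h₀) = 0 and ν₀ Z(Θ(ν₀, h₀)) ≠ 1. Then there exist ε, ε' > 0 and a continuously differentiable map 𝐡 : (ν₀ − ε, ν₀ + ε) → X with 𝐡(ν₀) = h₀ such that: (i) F(ν, 𝐡(ν)) = 0 and ν Z(Θ(ν, 𝐡(ν))) ≠ 1 for all ν ∈ (ν₀ − ε, ν₀ + ε); (ii) every solution of F(ν, h) = 0 with |ν − ν₀| < ε and ‖h − h₀‖ < ε' satisfies h = 𝐡(ν); and (iii) the derivative satisfies 𝐡'(ν) = (Z(𝐡(ν)) / (1 − ν Z(Θ(ν, 𝐡(ν))))) · Θ(ν, 𝐡(ν)). (Abstract version of the local branch Lemma 4.2 (no turning point), with the derivative formula obtained by combining the implicit function theorem with the rank-one inverse formula of Lemma 4.1.) -/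
/-- **Local branch of invariant measures, no turning point (abstract Lemma 4.2).**
Let `X` be a real Banach space, `Z` a continuous linear functional, `Θ : ℝ × X → X`
continuous, and `F : ℝ × X → X` (continuously) Fréchet differentiable with partial
derivatives `D_hF(ν,h) φ = φ − ν Z(φ) • Θ(ν,h)` and `D_νF(ν,h) = −Z(h) • Θ(ν,h)`.
Suppose `F (ν₀, h₀) = 0` and `ν₀ Z (Θ (ν₀, h₀)) ≠ 1`.  Then there exist `ε, ε' > 0` and a
continuously differentiable `𝐡 : (ν₀ − ε, ν₀ + ε) → X` with `𝐡 ν₀ = h₀` such that on the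
interval `F (ν, 𝐡 ν) = 0`, `ν Z (Θ (ν, 𝐡 ν)) ≠ 1`, and
`𝐡'(ν) = (Z (𝐡 ν) / (1 − ν Z (Θ (ν, 𝐡 ν)))) • Θ (ν, 𝐡 ν)`, and every solution of
`F (ν, h) = 0` with `|ν − ν₀| < ε`, `‖h − h₀‖ < ε'` satisfies `h = 𝐡 ν`. -/
theorem local_branch_no_turning_point
    {X : Type*} [NormedAddCommGroup X] [NormedSpace ℝ X] [CompleteSpace X]
    (Z : X →L[ℝ] ℝ) (Θ : ℝ × X → X) (hΘ : Continuous Θ)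
    (F : ℝ × X → X)
    (hDF : ∀ p : ℝ × X, HasFDerivAt F
      (ContinuousLinearMap.snd ℝ ℝ X
        - ((p.1 • Z).comp (ContinuousLinearMap.snd ℝ ℝ X)).smulRight (Θ p)
        - (ContinuousLinearMap.fst ℝ ℝ X).smulRight (Z p.2 • Θ p)) p)
    (ν₀ : ℝ) (h₀ : X)
    (hF₀ : F (ν₀, h₀) = 0)
    (hnd : ν₀ * Z (Θ (ν₀, h₀)) ≠ 1) :
    ∃ ε : ℝ, 0 < ε ∧ ∃ ε' : ℝ, 0 < ε' ∧ ∃ g : ℝ → X,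
      g ν₀ = h₀ ∧
      (∀ ν ∈ Set.Ioo (ν₀ - ε) (ν₀ + ε),
        F (ν, g ν) = 0 ∧
        ν * Z (Θ (ν, g ν)) ≠ 1 ∧
        HasDerivAt g ((Z (g ν) / (1 - ν * Z (Θ (ν, g ν)))) • Θ (ν, g ν)) ν) ∧
      (∀ ν : ℝ, ∀ h : X, |ν - ν₀| < ε → ‖h - h₀‖ < ε' → F (ν, h) = 0 → h = g ν) := by
  set dF : ℝ × X → (ℝ × X →L[ℝ] X) := fun p =>
    ContinuousLinearMap.snd ℝ ℝ X
        - ((p.1 • Z).comp (ContinuousLinearMap.snd ℝ ℝ X)).smulRight (Θ p)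
        - (ContinuousLinearMap.fst ℝ ℝ X).smulRight (Z p.2 • Θ p) with hdF
  have hdFapp : ∀ p q, dF p q = q.2 - (p.1 * Z q.2) • Θ p - q.1 • Z p.2 • Θ p := by
    intro p q
    simp [hdF]
  have hdFc : Continuous dF := by
    have e : dF = fun p => ContinuousLinearMap.snd ℝ ℝ X
        - p.1 • ContinuousLinearMap.smulRightL ℝ (ℝ × X) X
            (Z.comp (ContinuousLinearMap.snd ℝ ℝ X)) (Θ p)
        - ContinuousLinearMap.smulRightL ℝ (ℝ × X) X
            (ContinuousLinearMap.fst ℝ ℝ X) (Z p.2 • Θ p) := by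
      funext p
      refine ContinuousLinearMap.ext fun q => ?_
      rw [hdFapp]
      simp [mul_smul]
      exact smul_comm _ _ _
    rw [e]
    fun_prop
  have hcd : ContDiff ℝ 1 F := contDiff_one_iff_hasFDerivAt.2 ⟨dF, hdFc, hDF⟩
  have hfd : fderiv ℝ F (ν₀, h₀) = dF (ν₀, h₀) := (hDF _).fderiv
  have hne : 1 - ν₀ * Z (Θ (ν₀, h₀)) ≠ 0 := sub_ne_zero.2 (Ne.symm hnd)
  have hinv : (fderiv ℝ F (ν₀, h₀) ∘L .inr ℝ ℝ X).IsInvertible := by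
    rw [hfd]
    refine ContinuousLinearMap.IsInvertible.of_inverse
      (g := ContinuousLinearMap.id ℝ X +
        ((ν₀ / (1 - ν₀ * Z (Θ (ν₀, h₀)))) • Z).smulRight (Θ (ν₀, h₀))) ?_ ?_
    · refine ContinuousLinearMap.ext fun x => ?_
      simp only [ContinuousLinearMap.comp_apply, ContinuousLinearMap.inr_apply, hdFapp]
      simp only [ContinuousLinearMap.add_apply, ContinuousLinearMap.id_apply,
        ContinuousLinearMap.smulRight_apply, ContinuousLinearMap.smul_apply, map_add, map_smul,
        smul_eq_mul]
      match_scalars <;> field_simp <;> ring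
    · refine ContinuousLinearMap.ext fun x => ?_
      simp only [ContinuousLinearMap.comp_apply, ContinuousLinearMap.inr_apply, hdFapp]
      simp only [ContinuousLinearMap.add_apply, ContinuousLinearMap.id_apply,
        ContinuousLinearMap.smulRight_apply, ContinuousLinearMap.smul_apply, map_sub, map_smul,
        hdFapp, smul_eq_mul]
      match_scalars <;> field_simp <;> ring
  have cda : ContDiffAt ℝ 1 F (ν₀, h₀) := hcd.contDiffAt
  obtain ⟨g, hg0, hgF, hgu, hgc⟩ : ∃ g : ℝ → X, g ν₀ = h₀ ∧ (∀ᶠ ν in nhds ν₀, F (ν, g ν) = 0) ∧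
      (∀ᶠ v in nhds (ν₀, h₀), F v = 0 ↔ g v.1 = v.2) ∧ ContDiffAt ℝ 1 g ν₀ := by
    refine ⟨cda.implicitFunction one_ne_zero hinv,
      cda.implicitFunction_apply_self one_ne_zero hinv, ?_, ?_,
      cda.contDiffAt_implicitFunction one_ne_zero hinv⟩
    · simpa only [hF₀] using cda.eventually_apply_implicitFunction one_ne_zero hinv
    · simpa only [hF₀] using cda.eventually_apply_eq_iff_implicitFunction one_ne_zero hinv
  have hgn : ∀ᶠ ν in nhds ν₀, ν * Z (Θ (ν, g ν)) ≠ 1 := by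
    have hc : ContinuousAt g ν₀ := hgc.continuousAt
    have : ContinuousAt (fun ν => ν * Z (Θ (ν, g ν))) ν₀ := by fun_prop
    exact this.eventually_ne (by rwa [hg0])
  have hgd : ∀ᶠ ν in nhds ν₀, DifferentiableAt ℝ g ν :=
    (hgc.eventually (by simp)).mono fun ν h => h.differentiableAt one_ne_zero
  obtain ⟨ε₁, hε₁, H₁⟩ := Metric.eventually_nhds_iff.1
    ((hgF.eventually_nhds.and hgn).and hgd)
  obtain ⟨ε₂, hε₂, H₂⟩ := Metric.eventually_nhds_iff.1 hgu
  refine ⟨min ε₁ ε₂, lt_min hε₁ hε₂, ε₂, hε₂, g, hg0, ?_, ?_⟩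
  · intro ν hν
    have hd : dist ν ν₀ < ε₁ := by
      rw [Real.dist_eq, abs_lt]
      have := min_le_left ε₁ ε₂
      constructor <;> linarith [hν.1, hν.2]
    obtain ⟨⟨h1, h2⟩, h3⟩ := H₁ hd
    refine ⟨h1.self_of_nhds, h2, ?_⟩
    have hder := h3.hasDerivAt
    set d := deriv g ν
    have hcomp : HasDerivAt (fun t => F (t, g t)) (dF (ν, g ν) (1, d)) ν :=
      HasFDerivAt.comp_hasDerivAt (f := fun t => (t, g t)) ν (hDF (ν, g ν))
        ((hasDerivAt_id ν).prodMk hder)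
    have hz : HasDerivAt (fun t => F (t, g t)) 0 ν :=
      (hasDerivAt_const ν (0 : X)).congr_of_eventuallyEq h1
    have e := hcomp.unique hz
    rw [hdFapp] at e
    simp only [one_smul] at e
    have hn : 1 - ν * Z (Θ (ν, g ν)) ≠ 0 := sub_ne_zero.2 (Ne.symm h2)
    have eZ := congrArg Z e
    simp only [map_sub, map_smul, smul_eq_mul, map_zero] at eZ
    have ed : d = (ν * Z d + Z (g ν)) • Θ (ν, g ν) := by
      rw [add_smul, ← sub_eq_zero, ← e]; abel
    have ec : ν * Z d + Z (g ν) = Z (g ν) / (1 - ν * Z (Θ (ν, g ν))) := by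
      rw [eq_div_iff hn]
      linear_combination ν * eZ
    rw [← ec, ← ed]
    exact hder
  · intro ν h hν hh hF
    have : dist (ν, h) (ν₀, h₀) < ε₂ := by
      rw [Prod.dist_eq, max_lt_iff]
      refine ⟨?_, by rwa [dist_eq_norm]⟩
      rw [Real.dist_eq]
      exact lt_of_lt_of_le hν (min_le_right _ _)
    exact ((H₂ this).1 hF).symm
end
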